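/- Let S = b·a^A ⊆ BS(1,2) with |S| = k ≥ 3, and suppose |S²| = (3k − 2) + h < 4k − 4. Then h ≥ 0 and S is contained in a geometric progression {b·aᵘ, b·a^(u+d), ..., b·a^(u+(k+h−1)d)} of size k + h ≤ 2k − 3, where u = min(A) and d = gcd{x − u : x ∈ A}. -/

import Mathlib

open Pointwise

def BSRel (n : ℤ) : Set (FreeGroup Bool) :=
  {FreeGroup.of true * FreeGroup.of false * (FreeGroup.of false * FreeGroup.of true ^ n)⁻¹}

/-- The Baumslag–Solitar group `BS(1,n) = ⟨a, b ∣ a b = b aⁿ⟩`. -/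
abbrev BS (n : ℤ) : Type := PresentedGroup (BSRel n)

noncomputable instance (n : ℤ) : DecidableEq (BS n) := Classical.decEq _

/-- The generator `a` of `BS(1,n)`. -/
def bsa (n : ℤ) : BS n := PresentedGroup.of true

/-- The generator `b` of `BS(1,n)`. -/
def bsb (n : ℤ) : BS n := PresentedGroup.of false

section Kneser

variable {G : Type*} [AddCommGroup G] [Fintype G] [DecidableEq G]

/-- The stabilizer of a finite set, as a finite set. -/
def kstab (C : Finset G) : Finset G := Finset.univ.filter (fun g => ∀ c, c + g ∈ C ↔ c ∈ C)

theorem mem_kstab {C : Finset G} {g : G} : g ∈ kstab C ↔ ∀ c, c + g ∈ C ↔ c ∈ C := by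
  simp [kstab]

theorem kstab_zero (C : Finset G) : (0 : G) ∈ kstab C := by simp [mem_kstab]

theorem kstab_add {C : Finset G} {g h : G} (hg : g ∈ kstab C) (hh : h ∈ kstab C) :
    g + h ∈ kstab C := by
  rw [mem_kstab] at *
  intro c
  rw [← add_assoc, hh, hg]

theorem kstab_neg {C : Finset G} {g : G} (hg : g ∈ kstab C) : -g ∈ kstab C := by
  rw [mem_kstab] at *
  intro c
  rw [← hg (c + -g)]
  simp

theorem kstab_of_forward {C : Finset G} {g : G} (hg : ∀ c ∈ C, c + g ∈ C) : g ∈ kstab C := by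
  have h1 : C.image (fun c => c + g) ⊆ C := by
    intro x hx
    obtain ⟨c, hc, rfl⟩ := Finset.mem_image.1 hx
    exact hg c hc
  have h2 : C.image (fun c => c + g) = C := by
    apply Finset.eq_of_subset_of_card_le h1
    rw [Finset.card_image_of_injective _ (add_left_injective g)]
  rw [mem_kstab]
  intro c
  refine ⟨fun h => ?_, hg c⟩
  rw [← h2] at h
  obtain ⟨c', hc', h'⟩ := Finset.mem_image.1 h
  have : c' = c := add_right_cancel h'
  exact this ▸ hc'

theorem dyson_aux (n : ℕ) : ∀ A B : Finset G, B.card = n → (0 : G) ∈ A → (0 : G) ∈ B →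
    ∃ C : Finset G, C ⊆ A + B ∧ 0 ∈ C ∧ A.card + B.card ≤ C.card + (kstab C).card := by
  induction n using Nat.strong_induction_on with
  | _ n ih =>
  intro A B hn hA hB
  by_cases hAB : ∀ e ∈ A, ∀ b ∈ B, e + b ∈ A
  · refine ⟨A, ?_, hA, ?_⟩
    · intro x hx
      simpa using Finset.add_mem_add hx hB
    · have : B ⊆ kstab A := fun b hb => kstab_of_forward (fun c hc => hAB c hc b hb)
      have := Finset.card_le_card this
      omega
  · push Not at hAB
    obtain ⟨e, he, b, hb, heb⟩ := hAB
    have hinj : Function.Injective (fun x : G => e + x) := add_right_injective e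
    set B' := B.filter (fun x => e + x ∈ A) with hB'
    set A' := A ∪ B.image (fun x => e + x) with hA'
    have hlt : B'.card < n := by
      rw [← hn]
      apply Finset.card_lt_card
      rw [Finset.filter_ssubset]
      exact ⟨b, hb, heb⟩
    have hcard : A'.card + B'.card = A.card + B.card := by
      have h1 := Finset.card_union_add_card_inter A (B.image (fun x => e + x))
      have h2 : (A ∩ B.image (fun x => e + x)) = B'.image (fun x => e + x) := by
        ext y
        simp only [Finset.mem_inter, Finset.mem_image, hB', Finset.mem_filter]
        constructor
        · rintro ⟨h, x, hx, rfl⟩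
          exact ⟨x, ⟨hx, h⟩, rfl⟩
        · rintro ⟨x, ⟨hx, h⟩, rfl⟩
          exact ⟨h, x, hx, rfl⟩
      rw [h2, Finset.card_image_of_injective _ hinj, Finset.card_image_of_injective _ hinj] at h1
      exact h1
    have h0B' : (0 : G) ∈ B' := by simp [hB', hB, he]
    have h0A' : (0 : G) ∈ A' := by simp [hA', hA]
    obtain ⟨C, hC, h0, hc⟩ := ih _ hlt A' B' rfl h0A' h0B'
    refine ⟨C, fun x hx => ?_, h0, by omega⟩
    obtain ⟨p, hp, q, hq, rfl⟩ := Finset.mem_add.1 (hC hx)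
    have hq' := Finset.mem_filter.1 hq
    rcases Finset.mem_union.1 hp with hp | hp
    · exact Finset.add_mem_add hp hq'.1
    · obtain ⟨r, hr, rfl⟩ := Finset.mem_image.1 hp
      have : e + r + q = (e + q) + r := by abel
      rw [this]
      exact Finset.add_mem_add hq'.2 hr

theorem kstab_translate (C : Finset G) (t : G) :
    kstab (C.image (fun x => x + t)) = kstab C := by
  ext g
  have key : ∀ y, y ∈ C.image (fun x => x + t) ↔ y - t ∈ C := by
    intro y
    simp only [Finset.mem_image]
    constructor
    · rintro ⟨x, hx, rfl⟩
      simpa using hx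
    · intro h
      exact ⟨_, h, by simp⟩
  simp only [mem_kstab, key]
  constructor
  · intro h c
    have := h (c + t)
    rw [show c + t + g - t = c + g by abel, show c + t - t = c by abel] at this
    exact this
  · intro h c
    rw [show c + g - t = c - t + g by abel]
    exact h _

theorem dyson_point (A B : Finset G) (c : G) (hc : c ∈ A + B) :
    ∃ C : Finset G, C ⊆ A + B ∧ c ∈ C ∧ A.card + B.card ≤ C.card + (kstab C).card := by
  obtain ⟨a, ha, b, hb, rfl⟩ := Finset.mem_add.1 hc
  obtain ⟨C, h1, h2, h3⟩ := dyson_aux _ (A.image (fun x => x + -a)) (B.image (fun x => x + -b)) rfl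
    (Finset.mem_image.2 ⟨a, ha, by simp⟩) (Finset.mem_image.2 ⟨b, hb, by simp⟩)
  rw [Finset.card_image_of_injective _ (add_left_injective _),
    Finset.card_image_of_injective _ (add_left_injective _)] at h3
  refine ⟨C.image (fun x => x + (a + b)), ?_, ?_, ?_⟩
  · intro y hy
    obtain ⟨x, hx, rfl⟩ := Finset.mem_image.1 hy
    obtain ⟨p, hp, q, hq, rfl⟩ := Finset.mem_add.1 (h1 hx)
    obtain ⟨p', hp', rfl⟩ := Finset.mem_image.1 hp
    obtain ⟨q', hq', rfl⟩ := Finset.mem_image.1 hq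
    rw [show p' + -a + (q' + -b) + (a + b) = p' + q' by abel]
    exact Finset.add_mem_add hp' hq'
  · exact Finset.mem_image.2 ⟨0, h2, by simp⟩
  · rw [kstab_translate, Finset.card_image_of_injective _ (add_left_injective _)]
    exact h3

/-- Lower bound for `C₂ \ C₁`. -/
theorem diff_bound (C₁ C₂ : Finset G) (x : G) (hx2 : x ∈ C₂) (hx1 : x ∉ C₁) :
    ((kstab C₁).filter (fun g => x + g ∈ C₂)).card + ((kstab C₂).filter (fun g => x + g ∉ C₁)).card
      ≤ (C₂ \ C₁).card + (kstab C₁ ∩ kstab C₂).card := by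
  set P := (kstab C₁).filter (fun g => x + g ∈ C₂) with hP
  set Q := (kstab C₂).filter (fun g => x + g ∉ C₁) with hQ
  have h1 := Finset.card_union_add_card_inter P Q
  have h2 : P ∩ Q ⊆ kstab C₁ ∩ kstab C₂ :=
    Finset.inter_subset_inter (Finset.filter_subset _ _) (Finset.filter_subset _ _)
  have h3 : (P ∪ Q).image (fun g => x + g) ⊆ C₂ \ C₁ := by
    intro y hy
    obtain ⟨g, hg, rfl⟩ := Finset.mem_image.1 hy
    rw [Finset.mem_sdiff]
    rcases Finset.mem_union.1 hg with hg | hg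
    · obtain ⟨hg1, hg2⟩ := Finset.mem_filter.1 hg
      exact ⟨hg2, fun h => hx1 ((mem_kstab.1 hg1 x).1 h)⟩
    · obtain ⟨hg1, hg2⟩ := Finset.mem_filter.1 hg
      exact ⟨(mem_kstab.1 hg1 x).2 hx2, hg2⟩
  have h4 := Finset.card_le_card h3
  rw [Finset.card_image_of_injective _ (add_right_injective x)] at h4
  have h5 := Finset.card_le_card h2
  omega

theorem linked_count (C₁ C₂ : Finset G) (x g₁ g₂ : G) (h1 : g₁ ∈ kstab C₁) (h2 : g₂ ∈ kstab C₂) :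
    ((kstab C₁).filter (fun g => x + g ∈ C₂)).card +
      ((kstab C₁).filter (fun g => x + g₁ + g₂ + g ∉ C₂)).card = (kstab C₁).card := by
  have e : ((kstab C₁).filter (fun g => x + g₁ + g₂ + g ∈ C₂)).card =
      ((kstab C₁).filter (fun g => x + g ∈ C₂)).card := by
    refine Finset.card_bij (fun g _ => g₁ + g) ?_ ?_ ?_
    · intro g hg
      obtain ⟨ha, hb⟩ := Finset.mem_filter.1 hg
      refine Finset.mem_filter.2 ⟨kstab_add h1 ha, ?_⟩
      rw [← mem_kstab.1 h2]
      convert hb using 1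
      abel
    · intro a _ b _ h
      exact add_left_cancel h
    · intro g hg
      obtain ⟨ha, hb⟩ := Finset.mem_filter.1 hg
      refine ⟨-g₁ + g, Finset.mem_filter.2 ⟨kstab_add (kstab_neg h1) ha, ?_⟩, by simp⟩
      rw [← mem_kstab.1 h2] at hb
      convert hb using 1
      abel
  rw [← e]
  exact Finset.card_filter_add_card_filter_not _

theorem linked_done (C₁ C₂ : Finset G) (x g₁ g₂ : G) (h1 : g₁ ∈ kstab C₁) (h2 : g₂ ∈ kstab C₂)
    (hx2 : x ∈ C₂) (hx1 : x ∉ C₁) (hy1 : x + g₁ + g₂ ∈ C₁) (hy2 : x + g₁ + g₂ ∉ C₂) :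
    (kstab C₁).card ≤ (C₂ \ C₁).card + (kstab C₁ ∩ kstab C₂).card ∨
    (kstab C₂).card ≤ (C₁ \ C₂).card + (kstab C₁ ∩ kstab C₂).card := by
  have a1 := diff_bound C₁ C₂ x hx2 hx1
  have a2 := diff_bound C₂ C₁ (x + g₁ + g₂) hy1 hy2
  have a3 := linked_count C₁ C₂ x g₁ g₂ h1 h2
  have a4 := linked_count C₂ C₁ (x + g₁ + g₂) (-g₂) (-g₁) (kstab_neg h2) (kstab_neg h1)
  rw [show x + g₁ + g₂ + -g₂ + -g₁ = x by abel] at a4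
  rw [Finset.inter_comm (kstab C₂)] at a2
  omega

theorem one_side (C₁ C₂ : Finset G) (x : G) (hx2 : x ∈ C₂) (hx1 : x ∉ C₁) :
    ((kstab C₁).card ≤ (C₂ \ C₁).card + (kstab C₁ ∩ kstab C₂).card ∨
    (kstab C₂).card ≤ (C₁ \ C₂).card + (kstab C₁ ∩ kstab C₂).card) ∨
    (kstab C₂).card ≤ (C₂ \ C₁).card := by
  by_cases hP : ∀ g ∈ kstab C₁, x + g ∈ C₂
  · left; left
    have a1 := diff_bound C₁ C₂ x hx2 hx1
    rw [Finset.filter_true_of_mem hP] at a1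
    omega
  by_cases hQ : ∀ g ∈ kstab C₂, x + g ∉ C₁
  · right
    rw [← Finset.card_image_of_injective (kstab C₂) (add_right_injective x)]
    apply Finset.card_le_card
    intro y hy
    obtain ⟨g, hg, rfl⟩ := Finset.mem_image.1 hy
    exact Finset.mem_sdiff.2 ⟨(mem_kstab.1 hg x).2 hx2, hQ g hg⟩
  · left
    push Not at hP hQ
    obtain ⟨g₁, h1, hP⟩ := hP
    obtain ⟨g₂, h2, hQ⟩ := hQ
    refine linked_done C₁ C₂ x g₁ g₂ h1 h2 hx2 hx1 ?_ ?_
    · rw [show x + g₁ + g₂ = x + g₂ + g₁ by abel]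
      exact (mem_kstab.1 h1 _).2 hQ
    · rw [mem_kstab.1 h2]
      exact hP

theorem union_bound (C₁ C₂ : Finset G) (n : ℕ) (x y : G) (hx2 : x ∈ C₂) (hx1 : x ∉ C₁)
    (hy1 : y ∈ C₁) (hy2 : y ∉ C₂) (h1 : n ≤ C₁.card + (kstab C₁).card)
    (h2 : n ≤ C₂.card + (kstab C₂).card) :
    n ≤ (C₁ ∪ C₂).card + (kstab (C₁ ∪ C₂)).card := by
  have hK : kstab C₁ ∩ kstab C₂ ⊆ kstab (C₁ ∪ C₂) := by
    intro g hg
    obtain ⟨ha, hb⟩ := Finset.mem_inter.1 hg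
    rw [mem_kstab] at *
    intro c
    rw [Finset.mem_union, Finset.mem_union, ha, hb]
  have hK := Finset.card_le_card hK
  have u1 : (C₁ ∪ C₂).card = C₁.card + (C₂ \ C₁).card := by
    rw [Finset.union_comm, ← Finset.card_sdiff_add_card C₂ C₁]; omega
  have u2 : (C₁ ∪ C₂).card = C₂.card + (C₁ \ C₂).card := by
    rw [← Finset.card_sdiff_add_card C₁ C₂]; omega
  have o1 := one_side C₁ C₂ x hx2 hx1
  have o2 := one_side C₂ C₁ y hy1 hy2
  rw [Finset.inter_comm (kstab C₂)] at o2
  omega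

theorem kneser (A B : Finset G) (hA : A.Nonempty) (hB : B.Nonempty) :
    A.card + B.card ≤ (A + B).card + (kstab (A + B)).card := by
  classical
  set F := (A + B).powerset.filter (fun C => A.card + B.card ≤ C.card + (kstab C).card) with hF
  have hne : F.Nonempty := by
    obtain ⟨c, hc⟩ := hA.add hB
    obtain ⟨C, h1, _, h3⟩ := dyson_point A B c hc
    exact ⟨C, by simp [hF, h1, h3]⟩
  obtain ⟨C, hC, hmax⟩ := Finset.exists_max_image F Finset.card hne
  obtain ⟨hC1, hC2⟩ := Finset.mem_filter.1 hC
  rw [Finset.mem_powerset] at hC1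
  by_cases hEq : C = A + B
  · rw [← hEq]; exact hC2
  exfalso
  obtain ⟨x, hx, hxC⟩ := Finset.exists_of_ssubset (hC1.ssubset_of_ne hEq)
  obtain ⟨D, d1, d2, d3⟩ := dyson_point A B x hx
  have hDF : D ∈ F := by simp [hF, d1, d3]
  have hCD : ¬ C ⊆ D := by
    intro h
    have := Finset.card_lt_card (Finset.ssubset_iff_subset_ne.2 ⟨h, fun e => hxC (e ▸ d2)⟩)
    have := hmax D hDF
    omega
  obtain ⟨y, hy1, hy2⟩ := Finset.not_subset.1 hCD
  have hu := union_bound C D _ x y d2 hxC hy1 hy2 hC2 d3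
  have hUF : C ∪ D ∈ F := by
    simp only [hF, Finset.mem_filter, Finset.mem_powerset]
    exact ⟨Finset.union_subset hC1 d1, hu⟩
  have h1 := hmax _ hUF
  have h2 : C ⊂ C ∪ D := by
    rw [Finset.ssubset_iff_of_subset Finset.subset_union_left]
    exact ⟨x, Finset.mem_union_right _ d2, hxC⟩
  have := Finset.card_lt_card h2
  omega

theorem kneser_strong (A B H : Finset G) (hA : A.Nonempty) (hB : B.Nonempty)
    (hH : H = kstab (A + B)) :
    (A + H).card + (B + H).card ≤ (A + B).card + H.card := by
  have hHne : H.Nonempty := ⟨0, by rw [hH]; exact kstab_zero _⟩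
  have e : (A + H) + (B + H) = A + B := by
    ext z
    constructor
    · intro hz
      obtain ⟨p, hp, q, hq, rfl⟩ := Finset.mem_add.1 hz
      obtain ⟨a, ha, g, hg, rfl⟩ := Finset.mem_add.1 hp
      obtain ⟨b, hb, g', hg', rfl⟩ := Finset.mem_add.1 hq
      rw [hH] at hg hg'
      rw [show a + g + (b + g') = a + b + (g + g') by abel]
      exact (mem_kstab.1 (kstab_add hg hg') _).2 (Finset.add_mem_add ha hb)
    · intro hz
      obtain ⟨a, ha, b, hb, rfl⟩ := Finset.mem_add.1 hz
      have h0 : (0 : G) ∈ H := by rw [hH]; exact kstab_zero _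
      have := Finset.add_mem_add (Finset.add_mem_add ha h0) (Finset.add_mem_add hb h0)
      simpa using this
  have := kneser (A + H) (B + H) (hA.add hHne) (hB.add hHne)
  rw [e, ← hH] at this
  exact this

end Kneser

theorem cast_gen (l : ℕ) [NeZero l] (A : Finset ℤ) (D : Finset (ZMod l)) (hD : D.Nonempty)
    (hg : ∀ d : ℤ, (∀ x ∈ A, d ∣ x) → d ∣ 1)
    (h : ∀ x ∈ A, (x : ZMod l) ∈ kstab D) : D = Finset.univ := by
  let K : AddSubgroup ℤ :=
    { carrier := {z | (z : ZMod l) ∈ kstab D}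
      zero_mem' := by simpa using kstab_zero D
      add_mem' := by
        intro x y hx hy
        simpa using kstab_add hx hy
      neg_mem' := by
        intro x hx
        simpa using kstab_neg hx }
  obtain ⟨d, hd⟩ := Int.subgroup_cyclic K
  have hK : ∀ z, z ∈ K ↔ d ∣ z := by
    intro z
    rw [hd, AddSubgroup.mem_closure_singleton]
    constructor
    · rintro ⟨n, rfl⟩
      exact ⟨n, by simp [mul_comm]⟩
    · rintro ⟨n, rfl⟩
      exact ⟨n, by simp [mul_comm]⟩
  have h1 : d ∣ 1 := hg d (fun x hx => (hK x).1 (h x hx))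
  have hall : ∀ z : ℤ, (z : ZMod l) ∈ kstab D := fun z => (hK z).2 (h1.trans (one_dvd z))
  obtain ⟨t, ht⟩ := hD
  ext y
  simp only [Finset.mem_univ, iff_true]
  obtain ⟨z, hz⟩ := ZMod.intCast_surjective (y - t)
  have := (mem_kstab.1 (hall z) t).2 ht
  rw [hz] at this
  simpa using this

theorem lev_smel (A B : Finset ℤ) (l : ℕ) (hl : 0 < l) (h0 : 0 ∈ A) (hlA : (l : ℤ) ∈ A)
    (hA : ∀ x ∈ A, 0 ≤ x ∧ x ≤ l) (hB : B.Nonempty) (hBr : ∀ x ∈ B, 0 ≤ x ∧ x < l)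
    (hg : ∀ d : ℤ, (∀ x ∈ A, d ∣ x) → d ∣ 1) :
    l + B.card ≤ (A + B).card ∨ A.card + 2 * B.card ≤ (A + B).card + 2 := by
  have : NeZero l := ⟨hl.ne'⟩
  set π : ℤ → ZMod l := fun z => (z : ZMod l) with hπ
  have πadd : ∀ x y, π (x + y) = π x + π y := fun x y => by simp [hπ]
  have πl : π l = 0 := by simp [hπ]
  have π0 : π 0 = 0 := by simp [hπ]
  have πinj : ∀ x y : ℤ, 0 ≤ x → x < l → 0 ≤ y → y < l → π x = π y → x = y := by
    intro x y hx hx' hy hy' h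
    have := (ZMod.intCast_eq_intCast_iff' x y l).1 h
    rwa [Int.emod_eq_of_lt hx hx', Int.emod_eq_of_lt hy hy'] at this
  set A' := A.image π with hA'
  set B' := B.image π with hB'
  set H := kstab (A' + B') with hH
  have hC : (A + B).image π = A' + B' := by
    ext z
    simp only [hA', hB', Finset.mem_image, Finset.mem_add]
    constructor
    · rintro ⟨_, ⟨a, ha, b, hb, rfl⟩, rfl⟩
      exact ⟨π a, ⟨a, ha, rfl⟩, π b, ⟨b, hb, rfl⟩, (πadd a b).symm⟩
    · rintro ⟨_, ⟨a, ha, rfl⟩, _, ⟨b, hb, rfl⟩, rfl⟩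
      exact ⟨a + b, ⟨a, ha, b, hb, rfl⟩, πadd a b⟩
  have hA'ne : A'.Nonempty := ⟨π 0, Finset.mem_image_of_mem _ h0⟩
  have hB'ne : B'.Nonempty := hB.image _
  have h0A' : (0 : ZMod l) ∈ A' := by rw [← π0]; exact Finset.mem_image_of_mem _ h0
  have h0H : (0 : ZMod l) ∈ H := kstab_zero _
  have hDC : B' + H ⊆ A' + B' := by
    intro z hz
    obtain ⟨b, hb, g, hg, rfl⟩ := Finset.mem_add.1 hz
    refine (mem_kstab.1 hg b).2 ?_
    simpa using Finset.add_mem_add h0A' hb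
  set Bl := B.image (fun x => x + (l : ℤ)) with hBl
  have hBlcard : Bl.card = B.card := Finset.card_image_of_injective _ (add_left_injective _)
  have hBlsub : Bl ⊆ A + B := by
    intro z hz
    obtain ⟨b, hb, rfl⟩ := Finset.mem_image.1 hz
    rw [add_comm b (l : ℤ)]
    exact Finset.add_mem_add hlA hb
  have hBlD : ∀ z ∈ Bl, π z ∈ B' + H := by
    intro z hz
    obtain ⟨b, hb, rfl⟩ := Finset.mem_image.1 hz
    rw [πadd, πl]
    exact Finset.add_mem_add (Finset.mem_image_of_mem _ hb) h0H
  -- removing Bl keeps the image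
  have himg : ((A + B) \ Bl).image π = A' + B' := by
    apply subset_antisymm
    · rw [← hC]; exact Finset.image_subset_image Finset.sdiff_subset
    · intro z hz
      rw [← hC] at hz
      obtain ⟨w, hw, rfl⟩ := Finset.mem_image.1 hz
      by_cases hwB : w ∈ Bl
      · obtain ⟨b, hb, rfl⟩ := Finset.mem_image.1 hwB
        refine Finset.mem_image.2 ⟨b, Finset.mem_sdiff.2 ⟨?_, ?_⟩, ?_⟩
        · simpa using Finset.add_mem_add h0 hb
        · intro hbB
          obtain ⟨b', hb', h⟩ := Finset.mem_image.1 hbB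
          have h1 := hBr b hb
          have h2 := hBr b' hb'
          omega
        · rw [πadd, πl, add_zero]
      · exact Finset.mem_image_of_mem _ (Finset.mem_sdiff.2 ⟨hw, hwB⟩)
  have hsd : ((A + B) \ Bl).card + B.card = (A + B).card := by
    rw [← hBlcard]
    exact Finset.card_sdiff_add_card_eq_card hBlsub
  by_cases hcase : ∀ x ∈ A, ∀ y ∈ B' + H, y + π x ∈ B' + H
  · left
    have hu : B' + H = Finset.univ := by
      refine cast_gen l A _ (hB'ne.add ⟨0, h0H⟩) hg ?_
      intro x hx
      exact kstab_of_forward (fun y hy => hcase x hx y hy)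
    have hCu : A' + B' = Finset.univ := by
      apply Finset.eq_univ_of_forall
      intro z
      exact hDC (hu ▸ Finset.mem_univ z)
    have h1 : (((A + B) \ Bl).image π).card ≤ _ := Finset.card_image_le
    rw [himg, hCu, Finset.card_univ, ZMod.card] at h1
    omega
  right
  push Not at hcase
  obtain ⟨a, ha, y, hy, hay⟩ := hcase
  obtain ⟨b', hb', g, hgH, rfl⟩ := Finset.mem_add.1 hy
  obtain ⟨b, hb, rfl⟩ := Finset.mem_image.1 hb'
  have hc : π a + π b ∉ B' + H := by
    intro hmem
    apply hay
    obtain ⟨p, hp, q, hq, hpq⟩ := Finset.mem_add.1 hmem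
    rw [show π b + g + π a = p + (q + g) by rw [← add_assoc, hpq]; abel]
    exact Finset.add_mem_add hp (kstab_add hq hgH)
  have hsub : ∀ c z : ZMod l, z - c ∈ H ↔ z ∈ H.image (fun g => c + g) := by
    intro c z
    rw [Finset.mem_image]
    constructor
    · intro h
      exact ⟨_, h, by simp⟩
    · rintro ⟨g, hg, rfl⟩
      simpa using hg
  -- the classes
  set c := π a + π b with hcdef
  set Aa := A.filter (fun x => π x - π a ∈ H) with hAa
  set Bb := B.filter (fun x => π x - π b ∈ H) with hBb
  set Ec := (A + B).filter (fun z => π z - c ∈ H) with hEc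
  set E1 := ((A + B) \ Bl).filter (fun z => ¬ (π z - c ∈ H)) with hE1
  have hAane : Aa.Nonempty := ⟨a, by simp [hAa, ha, h0H]⟩
  have hBbne : Bb.Nonempty := ⟨b, by simp [hBb, hb, h0H]⟩
  have hEccard : Aa.card + Bb.card ≤ Ec.card + 1 := by
    have h1 := cauchy_davenport_add_of_linearOrder_isCancelAdd hAane hBbne
    have h2 : Aa + Bb ⊆ Ec := by
      intro z hz
      obtain ⟨p, hp, q, hq, rfl⟩ := Finset.mem_add.1 hz
      obtain ⟨hp1, hp2⟩ := Finset.mem_filter.1 hp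
      obtain ⟨hq1, hq2⟩ := Finset.mem_filter.1 hq
      refine Finset.mem_filter.2 ⟨Finset.add_mem_add hp1 hq1, ?_⟩
      rw [πadd, hcdef, show π p + π q - (π a + π b) = (π p - π a) + (π q - π b) by abel]
      exact kstab_add hp2 hq2
    have h3 := Finset.card_le_card h2
    omega
  have hBlEc : ∀ z ∈ Bl, ¬ (π z - c ∈ H) := by
    intro z hz hzc
    apply hc
    obtain ⟨p, hp, q, hq, hpq⟩ := Finset.mem_add.1 (hBlD z hz)
    rw [← hpq] at hzc
    rw [show c = p + (q + -(p + q - c)) by abel]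
    exact Finset.add_mem_add hp (kstab_add hq (kstab_neg hzc))
  have hEsplit : E1.card + Ec.card + B.card = (A + B).card := by
    have h1 : (((A + B) \ Bl).filter (fun z => π z - c ∈ H)).card + E1.card = ((A + B) \ Bl).card :=
      Finset.card_filter_add_card_filter_not _
    have : ((A + B) \ Bl).filter (fun z => π z - c ∈ H) = Ec := by
      ext z
      simp only [hEc, Finset.mem_filter, Finset.mem_sdiff]
      constructor
      · rintro ⟨⟨h1, _⟩, h2⟩
        exact ⟨h1, h2⟩
      · rintro ⟨h1, h2⟩
        exact ⟨⟨h1, fun h => hBlEc z h h2⟩, h2⟩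
    rw [this] at h1
    omega
  have hE1card : (A' + B').card ≤ E1.card + H.card := by
    have h1 : A' + B' ⊆ E1.image π ∪ H.image (fun g => c + g) := by
      intro z hz
      by_cases hzc : z - c ∈ H
      · exact Finset.mem_union_right _ ((hsub c z).1 hzc)
      · rw [← himg] at hz
        obtain ⟨w, hw, rfl⟩ := Finset.mem_image.1 hz
        exact Finset.mem_union_left _ (Finset.mem_image_of_mem _ (Finset.mem_filter.2 ⟨hw, hzc⟩))
    have h2 := (Finset.card_le_card h1).trans (Finset.card_union_le _ _)
    have h3 : (E1.image π).card ≤ E1.card := Finset.card_image_le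
    have h4 : (H.image (fun g => c + g)).card ≤ H.card := Finset.card_image_le
    omega
  have hcoset : ∀ (X : Finset (ZMod l)) (t : ZMod l), t ∈ X →
      (X.filter (fun z => ¬ (z - t ∈ H))).card + H.card ≤ (X + H).card := by
    intro X t ht
    rw [← Finset.card_image_of_injective H (add_right_injective t),
      ← Finset.card_union_of_disjoint]
    · apply Finset.card_le_card
      intro z hz
      rcases Finset.mem_union.1 hz with hz | hz
      · simpa using Finset.add_mem_add (Finset.mem_filter.1 hz).1 h0H
      · obtain ⟨g, hg, rfl⟩ := Finset.mem_image.1 hz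
        exact Finset.add_mem_add ht hg
    · rw [Finset.disjoint_left]
      intro z hz hz2
      exact (Finset.mem_filter.1 hz).2 ((hsub t z).2 hz2)
  have hkn := kneser_strong A' B' H hA'ne hB'ne hH
  have k1 := hcoset A' (π a) (Finset.mem_image_of_mem _ ha)
  have k2 := hcoset B' (π b) (Finset.mem_image_of_mem _ hb)
  have k3 : B.card ≤ Bb.card + (B'.filter (fun z => ¬ (z - π b ∈ H))).card := by
    have h1 : Bb.card + (B.filter (fun x => ¬ (π x - π b ∈ H))).card = B.card :=
      Finset.card_filter_add_card_filter_not _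
    have h2 : ((B.filter (fun x => ¬ (π x - π b ∈ H))).image π).card
        = (B.filter (fun x => ¬ (π x - π b ∈ H))).card := by
      apply Finset.card_image_of_injOn
      intro x hx y hy hxy
      have hx := hBr x (Finset.mem_filter.1 hx).1
      have hy := hBr y (Finset.mem_filter.1 hy).1
      exact πinj x y hx.1 hx.2 hy.1 hy.2 hxy
    have h3 : (B.filter (fun x => ¬ (π x - π b ∈ H))).image π ⊆
        B'.filter (fun z => ¬ (z - π b ∈ H)) := by
      intro z hz
      obtain ⟨x, hx, rfl⟩ := Finset.mem_image.1 hz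
      obtain ⟨hx1, hx2⟩ := Finset.mem_filter.1 hx
      exact Finset.mem_filter.2 ⟨Finset.mem_image_of_mem _ hx1, hx2⟩
    have h4 := Finset.card_le_card h3
    omega
  have k4 : A.card ≤ Aa.card + (A'.filter (fun z => ¬ (z - π a ∈ H))).card + 1 := by
    set R := A.filter (fun x => ¬ (π x - π a ∈ H)) with hR
    have h1 : Aa.card + R.card = A.card := Finset.card_filter_add_card_filter_not _
    have h2 : ((R.erase l).image π).card = (R.erase l).card := by
      apply Finset.card_image_of_injOn
      intro x hx y hy hxy
      have hx' := Finset.mem_erase.1 hx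
      have hy' := Finset.mem_erase.1 hy
      have hx := hA x (Finset.mem_filter.1 hx'.2).1
      have hy := hA y (Finset.mem_filter.1 hy'.2).1
      exact πinj x y hx.1 (lt_of_le_of_ne hx.2 hx'.1) hy.1 (lt_of_le_of_ne hy.2 hy'.1) hxy
    have h3 : (R.erase l).image π ⊆ A'.filter (fun z => ¬ (z - π a ∈ H)) := by
      intro z hz
      obtain ⟨x, hx, rfl⟩ := Finset.mem_image.1 hz
      obtain ⟨hx1, hx2⟩ := Finset.mem_filter.1 (Finset.mem_erase.1 hx).2
      exact Finset.mem_filter.2 ⟨Finset.mem_image_of_mem _ hx1, hx2⟩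
    have h4 := Finset.card_le_card h3
    have h5 : R.card ≤ (R.erase (l : ℤ)).card + 1 := by
      have := Finset.pred_card_le_card_erase (s := R) (a := (l : ℤ))
      omega
    omega
  omega

/-- The bound for `A + 2·A`, with `A` normalized. -/
theorem dilate_bound (A : Finset ℤ) (l : ℕ) (hl : 0 < l) (h0 : 0 ∈ A) (hlA : (l : ℤ) ∈ A)
    (hA : ∀ x ∈ A, 0 ≤ x ∧ x ≤ l) (hg : ∀ d : ℤ, (∀ x ∈ A, d ∣ x) → d ∣ 1) :
    4 * A.card ≤ (A + A.image (fun x => 2 * x)).card + 4 ∨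
    l + 2 * A.card ≤ (A + A.image (fun x => 2 * x)).card + 1 := by
  have hpart : ∀ (A₀ : Finset ℤ) (r : ℤ), (∀ x ∈ A₀, x % 2 = r) → A₀ ⊆ A → A₀.Nonempty →
      l + A₀.card ≤ ((A + A.image (fun x => 2 * x)).filter (fun z => z % 2 = r)).card ∨
      A.card + 2 * A₀.card ≤
        ((A + A.image (fun x => 2 * x)).filter (fun z => z % 2 = r)).card + 2 := by
    intro A₀ r hr hsub hne
    have hcard : (A₀.image (fun x => x / 2)).card = A₀.card := by
      apply Finset.card_image_of_injOn
      intro x hx y hy h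
      have h1 := hr x hx
      have h2 := hr y hy
      simp only at h
      omega
    have h1 := lev_smel A (A₀.image (fun x => x / 2)) l hl h0 hlA hA (hne.image _) (by
      intro z hz
      obtain ⟨x, hx, rfl⟩ := Finset.mem_image.1 hz
      have := hA x (hsub hx)
      omega) hg
    have h2 : (A + A₀.image (fun x => x / 2)).card ≤
        ((A + A.image (fun x => 2 * x)).filter (fun z => z % 2 = r)).card := by
      have hinj : Function.Injective (fun z : ℤ => 2 * z + r) := by
        intro x y h
        simp only at h
        omega
      rw [← Finset.card_image_of_injective _ hinj]
      apply Finset.card_le_card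
      intro z hz
      obtain ⟨w, hw, rfl⟩ := Finset.mem_image.1 hz
      obtain ⟨p, hp, q, hq, rfl⟩ := Finset.mem_add.1 hw
      obtain ⟨x, hx, rfl⟩ := Finset.mem_image.1 hq
      have hxr := hr x hx
      refine Finset.mem_filter.2 ⟨?_, by omega⟩
      rw [show 2 * (p + x / 2) + r = x + 2 * p by omega]
      exact Finset.add_mem_add (hsub hx) (Finset.mem_image_of_mem _ hp)
    rw [hcard] at h1
    omega
  have hodd : (A.filter (fun z => z % 2 = 1)).Nonempty := by
    by_contra hne
    rw [Finset.not_nonempty_iff_eq_empty, Finset.filter_eq_empty_iff] at hne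
    have := hg 2 (fun x hx => by have := hne hx; omega)
    norm_num at this
  have p0 := hpart (A.filter (fun z => z % 2 = 0)) 0 (fun x hx => (Finset.mem_filter.1 hx).2)
    (Finset.filter_subset _ _) ⟨0, by simp [h0]⟩
  have p1 := hpart (A.filter (fun z => z % 2 = 1)) 1 (fun x hx => (Finset.mem_filter.1 hx).2)
    (Finset.filter_subset _ _) hodd
  have split : ∀ X : Finset ℤ, (X.filter (fun z => z % 2 = 0)).card +
      (X.filter (fun z => z % 2 = 1)).card = X.card := by
    intro X
    rw [← Finset.card_filter_add_card_filter_not (s := X) (fun z => z % 2 = 0)]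
    congr 2
    apply Finset.filter_congr
    intro x _
    omega
  have s1 := split A
  have s2 := split (A + A.image (fun x => 2 * x))
  have hAl : A.card ≤ l + 1 := by
    have : A ⊆ Finset.Icc 0 (l : ℤ) := fun x hx => Finset.mem_Icc.2 (hA x hx)
    have := Finset.card_le_card this
    simpa using this
  have c1 := hodd.card_pos
  have c0 : 0 < (A.filter (fun z => z % 2 = 0)).card :=
    Finset.card_pos.2 ⟨0, by simp [h0]⟩
  omega

theorem bs_rel : bsa 2 * bsb 2 = bsb 2 * bsa 2 ^ (2 : ℤ) := by
  have h : PresentedGroup.mk (BSRel 2) (FreeGroup.of true * FreeGroup.of false *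
      (FreeGroup.of false * FreeGroup.of true ^ (2 : ℤ))⁻¹) = 1 :=
    PresentedGroup.one_of_mem (Set.mem_singleton _)
  rw [map_mul, map_inv, mul_inv_eq_one] at h
  simpa [bsa, bsb, PresentedGroup.of] using h

theorem bs_comm (x : ℤ) : bsa 2 ^ x * bsb 2 = bsb 2 * bsa 2 ^ (2 * x) := by
  have h : SemiconjBy (bsb 2) (bsa 2 ^ (2 : ℤ)) (bsa 2) := bs_rel.symm
  have := (h.zpow_right x).eq
  rw [← zpow_mul] at this
  exact this.symm

/-- The affine action on the rationals. -/
def bsAct : Bool → Equiv.Perm ℚ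
  | true => Equiv.addRight 1
  | false => Equiv.mulLeft₀ (1 / 2) (by norm_num)

theorem bsa_inj : Function.Injective (fun z : ℤ => bsa 2 ^ z) := by
  have hrel : ∀ r ∈ BSRel 2, FreeGroup.lift bsAct r = 1 := by
    intro r hr
    rw [BSRel, Set.mem_singleton_iff] at hr
    subst hr
    rw [map_mul, map_inv, mul_inv_eq_one]
    ext x
    simp [bsAct, zpow_ofNat, pow_two]
    ring
  let f := PresentedGroup.toGroup hrel
  have hf : f (bsa 2) = Equiv.addRight (1 : ℚ) := PresentedGroup.toGroup.of hrel
  intro x y h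
  have h2 : f (bsa 2 ^ x) 0 = f (bsa 2 ^ y) 0 := by
    simp only at h
    rw [h]
  rw [map_zpow, map_zpow, hf] at h2
  simpa using h2

theorem stmt10 (A : Finset ℤ) (hA : A.Nonempty) (S : Finset (BS 2)) (k : ℕ) (h : ℤ)
    (hS : S = A.image (fun x => bsb 2 * bsa 2 ^ x))
    (hk : S.card = k) (hk3 : 3 ≤ k)
    (hcard : ((S * S).card : ℤ) = 3 * k - 2 + h)
    (hlt : ((S * S).card : ℤ) < 4 * k - 4) :
    0 ≤ h ∧
    S ⊆ (Finset.range (k + h.toNat)).image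
        (fun i : ℕ => bsb 2 * bsa 2 ^ (A.min' hA + (i : ℤ) * A.gcd (fun x => x - A.min' hA))) ∧
    (k : ℤ) + h ≤ 2 * k - 3 := by
  have hinj1 : Function.Injective (fun x : ℤ => bsb 2 * bsa 2 ^ x) := by
    intro x y hxy
    exact bsa_inj (mul_left_cancel hxy)
  have hinj2 : Function.Injective (fun x : ℤ => bsb 2 * (bsb 2 * bsa 2 ^ x)) := by
    intro x y hxy
    exact hinj1 (mul_left_cancel hxy)
  have hAk : A.card = k := by
    rw [← hk, hS, Finset.card_image_of_injective _ hinj1]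
  set u := A.min' hA with hu
  set d := A.gcd (fun x => x - u) with hd
  have hu_mem : u ∈ A := A.min'_mem hA
  have hu_le : ∀ x ∈ A, u ≤ x := fun x hx => A.min'_le x hx
  have hd_dvd : ∀ x ∈ A, d ∣ x - u := fun x hx => Finset.gcd_dvd hx
  have hd_nn : 0 ≤ d := by
    have : normalize d = d := Finset.normalize_gcd
    exact Int.nonneg_of_normalize_eq_self this
  set v := A.max' hA with hv
  have hv_mem : v ∈ A := A.max'_mem hA
  have huv : u < v := by
    apply Finset.min'_lt_max'_of_card
    omega
  have hd_pos : 0 < d := by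
    rcases hd_nn.lt_or_eq with h | h
    · exact h
    · have := hd_dvd v hv_mem
      rw [← h, zero_dvd_iff] at this
      omega
  -- normalized set
  set A1 := A.image (fun x => (x - u) / d) with hA1
  have hback : ∀ x ∈ A, d * ((x - u) / d) + u = x := by
    intro x hx
    rw [Int.mul_ediv_cancel' (hd_dvd x hx)]
    ring
  have hA1card : A1.card = k := by
    rw [← hAk]
    apply Finset.card_image_of_injOn
    intro x hx y hy hxy
    simp only at hxy
    rw [← hback x hx, ← hback y hy, hxy]
  have hSS : (S * S).card = (A1 + A1.image (fun x => 2 * x)).card := by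
    have hinj3 : Function.Injective (fun z : ℤ => d * z + 3 * u) := by
      intro x y hxy
      have : d * x = d * y := by simpa using hxy
      exact mul_left_cancel₀ hd_pos.ne' this
    rw [← Finset.card_image_of_injective _ (hinj2.comp hinj3)]
    congr 1
    have key : ∀ x ∈ A, ∀ y ∈ A, bsb 2 * bsa 2 ^ x * (bsb 2 * bsa 2 ^ y) =
        bsb 2 * (bsb 2 * bsa 2 ^ (d * ((y - u) / d + 2 * ((x - u) / d)) + 3 * u)) := by
      intro x hx y hy
      have e : d * ((y - u) / d + 2 * ((x - u) / d)) + 3 * u = 2 * x + y := by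
        linear_combination hback y hy + 2 * hback x hx
      rw [e, zpow_add, ← mul_assoc (bsb 2) (bsa 2 ^ (2 * x)), ← bs_comm]
      simp only [mul_assoc]
    ext z
    rw [hS]
    simp only [Finset.mem_mul, Finset.mem_image, Finset.mem_add, hA1, Function.comp]
    constructor
    · rintro ⟨_, ⟨x, hx, rfl⟩, _, ⟨y, hy, rfl⟩, rfl⟩
      exact ⟨_, ⟨_, ⟨y, hy, rfl⟩, _, ⟨_, ⟨x, hx, rfl⟩, rfl⟩, rfl⟩, (key x hx y hy).symm⟩
    · rintro ⟨_, ⟨_, ⟨y, hy, rfl⟩, _, ⟨_, ⟨x, hx, rfl⟩, rfl⟩, rfl⟩, rfl⟩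
      exact ⟨_, ⟨x, hx, rfl⟩, _, ⟨y, hy, rfl⟩, key x hx y hy⟩
  have hmono : ∀ x ∈ A, 0 ≤ (x - u) / d ∧ (x - u) / d ≤ (v - u) / d := by
    intro x hx
    have h1 := hu_le x hx
    have h2 : x ≤ v := A.le_max' x hx
    exact ⟨Int.ediv_nonneg (by omega) hd_nn, Int.ediv_le_ediv hd_pos (by omega)⟩
  obtain ⟨l, hl⟩ := Int.eq_ofNat_of_zero_le (hmono v hv_mem).1
  have hlpos : 0 < l := by
    rcases Nat.eq_zero_or_pos l with h0 | h0
    · have := hback v hv_mem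
      rw [hl, h0] at this
      simp at this
      omega
    · exact h0
  have hmain := dilate_bound A1 l hlpos (Finset.mem_image.2 ⟨u, hu_mem, by simp⟩)
    (Finset.mem_image.2 ⟨v, hv_mem, hl⟩) (by
      intro z hz
      obtain ⟨x, hx, rfl⟩ := Finset.mem_image.1 hz
      rw [← hl]
      exact hmono x hx) (by
      intro e he
      have h1 : d * e ∣ d := by
        conv_rhs => rw [hd]
        apply Finset.dvd_gcd
        intro x hx
        obtain ⟨m, hm⟩ := he _ (Finset.mem_image_of_mem _ hx)
        refine ⟨m, ?_⟩
        have := hback x hx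
        rw [hm] at this
        linear_combination -this
      have h2 : d * e ∣ d * 1 := by simpa using h1
      exact (mul_dvd_mul_iff_left hd_pos.ne').1 h2)
  have hlk : k ≤ l + 1 := by
    rw [← hA1card]
    have : A1 ⊆ Finset.Icc 0 (l : ℤ) := by
      intro z hz
      obtain ⟨x, hx, rfl⟩ := Finset.mem_image.1 hz
      rw [Finset.mem_Icc, ← hl]
      exact hmono x hx
    simpa using Finset.card_le_card this
  rw [hSS] at hcard hlt
  rw [hA1card] at hmain
  refine ⟨by omega, ?_, by omega⟩
  intro s hs
  rw [hS] at hs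
  obtain ⟨x, hx, rfl⟩ := Finset.mem_image.1 hs
  obtain ⟨i, hi⟩ := Int.eq_ofNat_of_zero_le (hmono x hx).1
  have hil := (hmono x hx).2
  rw [hl, hi] at hil
  refine Finset.mem_image.2 ⟨i, Finset.mem_range.2 (by omega), ?_⟩
  have := hback x hx
  rw [hi] at this
  rw [← this]
  congr 2
  ring
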